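/- arXiv:1706.05654 — 3 statements merged into one kernel-verified Lean document; each statement's English description precedes it below -/
import Mathlib

section
/- Let $x, y \in \mathbb{R}^d$, $C_1 > 0$, and $C_2 = \sqrt{\|y - x\|_2^2 + C_1^2 (d-1)^2} + C_1$. Then there exists a $d$-simplex $\Pi$ (the convex hull of $d+1$ affinely independent points) such that $x + C_1 \cdot \overline{\mathbb{B}}_{2,d} \subseteq \Pi \subseteq y + C_2 \cdot \overline{\mathbb{B}}_{2,d}$. -/
open scoped RealInnerProductSpace Pointwise

/-- A finite family of `finrank + 1` points whose convex hull contains a ball of positive radius is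
affinely independent. -/
theorem affineIndependent_of_closedBall_subset_convexHull {E : Type*} [NormedAddCommGroup E]
    [NormedSpace ℝ E] [FiniteDimensional ℝ E] {n : ℕ} (hn : Module.finrank ℝ E = n)
    {f : Fin (n + 1) → E} {x : E} {r : ℝ} (hr : 0 < r)
    (h : Metric.closedBall x r ⊆ convexHull ℝ (Set.range f)) : AffineIndependent ℝ f := by
  have hint : (interior (convexHull ℝ (Set.range f))).Nonempty :=
    ⟨x, mem_interior_iff_mem_nhds.2 (Filter.mem_of_superset (Metric.closedBall_mem_nhds x hr) h)⟩
  have hspan := interior_convexHull_nonempty_iff_affineSpan_eq_top.1 hint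
  rw [affineIndependent_iff_finrank_vectorSpan_eq ℝ f (Fintype.card_fin _),
    ← direction_affineSpan, hspan, AffineSubspace.direction_top, finrank_top, hn]

/-- Every unit vector of `ℝⁿ` is the main diagonal direction of some orthonormal basis. -/
theorem exists_orthonormalBasis_inner_eq {n : ℕ} (hn : 0 < n) {e : EuclideanSpace ℝ (Fin n)}
    (he : ‖e‖ = 1) :
    ∃ b : OrthonormalBasis (Fin n) ℝ (EuclideanSpace ℝ (Fin n)), ∀ i, ⟪b i, e⟫ = (√n)⁻¹ := by
  have hn' : (0 : ℝ) < n := by exact_mod_cast hn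
  set v : EuclideanSpace ℝ (Fin n) := WithLp.toLp 2 fun _ => (√n)⁻¹
  have hv : ‖v‖ = 1 := by
    simp [v, EuclideanSpace.norm_eq, hn'.le, hn'.ne']
  have hR := Submodule.reflection_sub (hv.trans he.symm)
  generalize (ℝ ∙ (v - e))ᗮ.reflection = R at hR
  refine ⟨(EuclideanSpace.basisFun (Fin n) ℝ).map R, fun i => ?_⟩
  rw [← hR, OrthonormalBasis.map_apply, LinearIsometryEquiv.inner_map_map]
  simp [v, EuclideanSpace.inner_single_left]

/-- The edge scale of the base of the simplex; `h` is the height of its apex. -/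
theorem exists_base_scale {n m a t h : ℝ} (hn : 0 < n) (hm : 0 ≤ m) (ht : 0 ≤ t) (ha : 0 ≤ a)
    (hat : a ^ 2 = t ^ 2 + m ^ 2) (hh : h = t + a + 1) :
    ∃ β : ℝ, 0 < β ∧ n * m * (h + 1) ≤ β ^ 2 * (h - 1) ∧
      β ^ 2 * m = n * (a - t) * (h + 1) := by
  subst hh
  rcases hm.eq_or_lt with rfl | hm
  · obtain rfl : a = t := by nlinarith
    exact ⟨1, one_pos, by linarith, by ring⟩
  · have ha' : 0 < a := by nlinarith [sq_nonneg t, sq_pos_of_pos hm]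
    have hpos : 0 < n * m * (t + a + 2) / (t + a) := by positivity
    refine ⟨√(n * m * (t + a + 2) / (t + a)), Real.sqrt_pos.2 hpos, ?_, ?_⟩
    · rw [Real.sq_sqrt hpos.le]
      apply le_of_eq
      field_simp
      ring
    · rw [Real.sq_sqrt hpos.le]
      have : t + a ≠ 0 := by positivity
      field_simp
      linear_combination (-(t + a + 2)) * hat

/-- A simplex with apex on the line `ℝ e` and regular base orthogonal to `e` that contains the
unit ball and is contained in a ball centered at `t • e`. -/
theorem exists_simplex_unit_ball {E : Type*} [NormedAddCommGroup E] [InnerProductSpace ℝ E]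
    {n : ℕ} (hn : 0 < n) (b : OrthonormalBasis (Fin n) ℝ E) {e : E} (he : ‖e‖ = 1)
    (hb : ∀ i, ⟪b i, e⟫ = (√n)⁻¹) {t : ℝ} (ht : 0 ≤ t) :
    ∃ f : Fin (n + 1) → E, Metric.closedBall 0 1 ⊆ convexHull ℝ (Set.range f) ∧
      ∀ i, ‖f i - t • e‖ ≤ √(t ^ 2 + ((n : ℝ) - 1) ^ 2) + 1 := by
  have hn1 : (1 : ℝ) ≤ n := by exact_mod_cast hn
  have hn0 : (0 : ℝ) < n := by linarith
  have hee : ⟪e, e⟫ = 1 := by rw [real_inner_self_eq_norm_sq, he, one_pow]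
  have hbb (i) : ⟪b i, b i⟫ = 1 := by simp [b.norm_eq_one i]
  set r : ℝ := (√n)⁻¹ with hr
  have hrn : (n : ℝ) * r ^ 2 = 1 := by
    rw [hr, inv_pow, Real.sq_sqrt hn0.le, mul_inv_cancel₀ hn0.ne']
  have hsum : ∑ i, b i = ((n : ℝ) * r) • e := by
    have h1 := b.sum_repr' e
    simp only [hb, ← Finset.smul_sum] at h1
    rw [← h1, smul_smul, mul_assoc, ← sq, hrn, one_smul]
  set m : ℝ := (n : ℝ) - 1 with hm
  set a : ℝ := √(t ^ 2 + m ^ 2) with ha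
  have ha0 : 0 ≤ a := Real.sqrt_nonneg _
  have ha2 : a ^ 2 = t ^ 2 + m ^ 2 := Real.sq_sqrt (by positivity)
  obtain ⟨h, hh⟩ : ∃ h, h = t + a + 1 := ⟨_, rfl⟩
  obtain ⟨β, hβ, hβ1, hβ2⟩ :=
    exists_base_scale hn0 (sub_nonneg.2 hn1) ht ha0 ha2 hh
  have hh1 : 0 < h + 1 := by linarith
  refine ⟨Fin.cons (h • e) fun i => -e + β • (b i - r • e), fun p hp => ?_, fun i => ?_⟩
  · have hp1 : ⟪p, p⟫ ≤ 1 := by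
      rw [mem_closedBall_zero_iff] at hp
      rw [real_inner_self_eq_norm_sq]
      exact pow_le_one₀ (norm_nonneg p) hp
    obtain ⟨z, hz⟩ : ∃ z, z = ⟪e, p⟫ := ⟨_, rfl⟩
    have hz2 : z ^ 2 ≤ 1 := by
      have := real_inner_mul_inner_self_le e p
      rw [← hz, hee] at this
      nlinarith
    have hz1 : -1 ≤ z ∧ z ≤ 1 := abs_le.1 ((sq_le_one_iff_abs_le_one z).1 hz2)
    have hcoord (i) : (⟪b i, p⟫ - z * r) ^ 2 * n ≤ m * (1 - z ^ 2) := by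
      have hcs := real_inner_mul_inner_self_le (p - z • e) (b i - r • e)
      have h1 : ⟪p - z • e, b i - r • e⟫ = ⟪b i, p⟫ - z * r := by
        simp only [inner_sub_left, inner_sub_right, real_inner_smul_left, real_inner_smul_right,
          hee, hb, real_inner_comm e p, real_inner_comm (b i) e, real_inner_comm (b i) p, ← hz]
        ring
      have h2 : ⟪p - z • e, p - z • e⟫ = ⟪p, p⟫ - z ^ 2 := by
        simp only [inner_sub_left, inner_sub_right, real_inner_smul_left, real_inner_smul_right,
          hee, real_inner_comm e p, ← hz]
        ring
      have h3 : ⟪b i - r • e, b i - r • e⟫ = 1 - r ^ 2 := by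
        simp only [inner_sub_left, inner_sub_right, real_inner_smul_left, real_inner_smul_right,
          hee, hbb, hb, real_inner_comm (b i) e]
        ring
      rw [h1, h2, h3] at hcs
      have hm0 : 0 ≤ m := sub_nonneg.2 hn1
      calc (⟪b i, p⟫ - z * r) ^ 2 * n ≤ (⟪p, p⟫ - z ^ 2) * (1 - r ^ 2) * n := by
            rw [sq]; exact mul_le_mul_of_nonneg_right hcs hn0.le
        _ = m * (⟪p, p⟫ - z ^ 2) := by
            rw [hm]; linear_combination (-(⟪p, p⟫ - z ^ 2)) * hrn
        _ ≤ m * (1 - z ^ 2) := by gcongr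
    set A : ℝ := (h - z) / (h + 1) with hA
    have hA1 : (z + 1) / (h + 1) + A = 1 := by rw [hA]; field_simp; ring
    have hsc : r * ∑ i, ⟪b i, p⟫ = z := by
      rw [← sum_inner, hsum, real_inner_smul_left, ← hz]
      linear_combination z * hrn
    let w : Fin (n + 1) → ℝ :=
      Fin.cons ((z + 1) / (h + 1)) fun i => A / n + β⁻¹ * (⟪b i, p⟫ - z * r)
    have hw0 : ∀ i ∈ Finset.univ, 0 ≤ w i := by
      intro i _
      cases i using Fin.cases with
      | zero => exact div_nonneg (by linarith) hh1.le
      | succ i =>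
        change 0 ≤ A / n + β⁻¹ * (⟪b i, p⟫ - z * r)
        have hi := hcoord i
        generalize ⟪b i, p⟫ - z * r = D at hi
        have hsq : (n * (h + 1) * D) ^ 2 ≤ (β * (h - z)) ^ 2 := by
          calc (n * (h + 1) * D) ^ 2 = n * (h + 1) ^ 2 * (D ^ 2 * n) := by ring
            _ ≤ n * (h + 1) ^ 2 * (m * (1 - z ^ 2)) := by gcongr
            _ = (h + 1) * (1 - z ^ 2) * (n * m * (h + 1)) := by ring
            _ ≤ (h + 1) * (1 - z ^ 2) * (β ^ 2 * (h - 1)) :=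
                mul_le_mul_of_nonneg_left hβ1 (mul_nonneg hh1.le (sub_nonneg.2 hz2))
            _ ≤ (β * (h - z)) ^ 2 := by
                linarith [sq_nonneg (β * (h * z - 1))]
        have hD := (abs_le_of_sq_le_sq' hsq (mul_nonneg hβ.le (by linarith))).1
        have heq : A / n + β⁻¹ * D =
            (β * (h - z) + n * (h + 1) * D) / (n * (h + 1) * β) := by
          rw [hA]
          field_simp
        rw [heq]
        exact div_nonneg (by linarith) (by positivity)
    have hsum1 : ∑ i, (A / n + β⁻¹ * (⟪b i, p⟫ - z * r)) = A := by
      have hdev : ∑ i, (⟪b i, p⟫ - z * r) = 0 := by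
        rw [Finset.sum_sub_distrib, Finset.sum_const, Finset.card_univ, Fintype.card_fin,
          nsmul_eq_mul]
        linear_combination n * r * hsc - (∑ i, ⟪b i, p⟫) * hrn
      rw [Finset.sum_add_distrib, ← Finset.mul_sum, hdev, Finset.sum_const, Finset.card_univ,
        Fintype.card_fin, nsmul_eq_mul, mul_div_cancel₀ _ hn0.ne', mul_zero, add_zero]
    have hsum2 : ∑ i, (A / n + β⁻¹ * (⟪b i, p⟫ - z * r)) • b i =
        (A * r) • e + β⁻¹ • (p - z • e) := by
      simp only [add_smul, mul_smul, sub_smul, Finset.sum_add_distrib, Finset.sum_sub_distrib,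
        ← Finset.smul_sum, b.sum_repr', hsum]
      match_scalars
      · field_simp
        linear_combination (-z) * hrn
      · rfl
    have hw1 : ∑ i, w i = 1 := by
      rw [Fin.sum_univ_succ]
      simp only [w, Fin.cons_zero, Fin.cons_succ]
      rw [hsum1, hA1]
    have hwp : ∑ i, w i • (Fin.cons (h • e) (fun i => -e + β • (b i - r • e)) :
        Fin (n + 1) → E) i = p := by
      rw [Fin.sum_univ_succ]
      simp only [w, Fin.cons_zero, Fin.cons_succ]
      have hterm (c : ℝ) (u : E) :
          c • (-e + β • (u - r • e)) = β • (c • u) - c • ((1 + β * r) • e) := by module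
      simp only [hterm, Finset.sum_sub_distrib, ← Finset.smul_sum, ← Finset.sum_smul, hsum1,
        hsum2]
      match_scalars
      · rw [hA]
        field_simp
        ring
      · field_simp
    rw [← hwp]
    exact (convex_convexHull ℝ _).sum_mem hw0 hw1
      fun i _ => subset_convexHull ℝ _ (Set.mem_range_self i)
  · cases i using Fin.cases with
    | zero =>
      rw [Fin.cons_zero, ← sub_smul, norm_smul, he, mul_one, hh, Real.norm_of_nonneg (by linarith)]
      linarith
    | succ i =>
      rw [Fin.cons_succ]
      have hX : β ^ 2 * (1 - r ^ 2) = (a - t) * (h + 1) :=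
        mul_left_cancel₀ hn0.ne' (by linear_combination hβ2 - β ^ 2 * hrn)
      refine le_of_sq_le_sq ?_ (by positivity)
      rw [← real_inner_self_eq_norm_sq]
      simp only [inner_sub_left, inner_sub_right, inner_add_left, inner_add_right, inner_neg_left,
        inner_neg_right, real_inner_smul_left, real_inner_smul_right, hee, hbb, hb,
        real_inner_comm (b i) e]
      rw [hh] at hX
      linarith


/-- **Simplex between two Euclidean balls.**
Let `x, y ∈ ℝ^d`, `C₁ > 0`, and `C₂ = √(‖y - x‖² + C₁²(d-1)²) + C₁`.  Then there is a
`d`-simplex `Π` (the convex hull of `d+1` affinely independent points) with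
`B̄(x, C₁) ⊆ Π ⊆ B̄(y, C₂)`. -/
theorem simplex_between_balls (d : ℕ) (x y : EuclideanSpace ℝ (Fin d))
    (C₁ : ℝ) (hC₁ : 0 < C₁) :
    ∃ f : Fin (d + 1) → EuclideanSpace ℝ (Fin d),
      AffineIndependent ℝ f ∧
      Metric.closedBall x C₁ ⊆ convexHull ℝ (Set.range f) ∧
      convexHull ℝ (Set.range f) ⊆
        Metric.closedBall y
          (Real.sqrt (‖y - x‖ ^ 2 + C₁ ^ 2 * ((d : ℝ) - 1) ^ 2) + C₁) := by
  have hfin : Module.finrank ℝ (EuclideanSpace ℝ (Fin d)) = d := by simp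
  suffices H : ∃ f : Fin (d + 1) → EuclideanSpace ℝ (Fin d),
      Metric.closedBall x C₁ ⊆ convexHull ℝ (Set.range f) ∧
      ∀ i, ‖f i - y‖ ≤ √(‖y - x‖ ^ 2 + C₁ ^ 2 * ((d : ℝ) - 1) ^ 2) + C₁ by
    obtain ⟨f, hf, hfy⟩ := H
    refine ⟨f, affineIndependent_of_closedBall_subset_convexHull hfin hC₁ hf, hf,
      convexHull_min ?_ (convex_closedBall _ _)⟩
    rintro _ ⟨i, rfl⟩
    exact mem_closedBall_iff_norm.2 (hfy i)
  rcases Nat.eq_zero_or_pos d with rfl | hd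
  · refine ⟨fun _ => x, fun p _ => ?_, fun i => ?_⟩
    · rw [Subsingleton.elim p x]
      exact subset_convexHull ℝ _ ⟨0, rfl⟩
    · rw [Subsingleton.elim y x, sub_self, norm_zero]
      positivity
  obtain ⟨e, he, hye⟩ : ∃ e : EuclideanSpace ℝ (Fin d), ‖e‖ = 1 ∧ y - x = ‖y - x‖ • e := by
    rcases eq_or_ne (y - x) 0 with h0 | h0
    · exact ⟨EuclideanSpace.single ⟨0, hd⟩ 1, by simp, by simp [h0]⟩
    · exact ⟨‖y - x‖⁻¹ • (y - x), norm_smul_inv_norm h0, by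
        rw [smul_inv_smul₀ (norm_ne_zero_iff.2 h0)]⟩
  obtain ⟨b, hb⟩ := exists_orthonormalBasis_inner_eq hd he
  obtain ⟨f, hf, hft⟩ :=
    exists_simplex_unit_ball hd b he hb (t := ‖y - x‖ / C₁) (by positivity)
  refine ⟨fun i => x + C₁ • f i, ?_, fun i => ?_⟩
  · have hrange : (Set.range fun i => x + C₁ • f i) = x +ᵥ C₁ • Set.range f := by
      rw [← Set.range_smul, ← Set.image_vadd, ← Set.range_comp]
      rfl
    rw [hrange, convexHull_vadd, convexHull_smul]
    calc Metric.closedBall x C₁ = x +ᵥ C₁ • Metric.closedBall (0 : EuclideanSpace ℝ (Fin d)) 1 := by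
          rw [smul_unitClosedBall_of_nonneg hC₁.le, vadd_closedBall_zero]
      _ ⊆ _ := Set.vadd_set_mono (Set.smul_set_mono hf)
  · have hfy : x + C₁ • f i - y = C₁ • (f i - (‖y - x‖ / C₁) • e) := by
      rw [smul_sub, smul_smul, mul_div_cancel₀ _ hC₁.ne', ← hye]
      abel
    have hsq : ‖y - x‖ ^ 2 + C₁ ^ 2 * ((d : ℝ) - 1) ^ 2 =
        C₁ ^ 2 * ((‖y - x‖ / C₁) ^ 2 + ((d : ℝ) - 1) ^ 2) := by
      field_simp
    rw [hfy, norm_smul, Real.norm_of_nonneg hC₁.le, hsq, Real.sqrt_mul (sq_nonneg _),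
      Real.sqrt_sq hC₁.le, ← mul_add_one]
    exact mul_le_mul_of_nonneg_left (hft i) hC₁.le
end

section
/- Let $d \geq 2$ and suppose $a_1, \ldots, a_d > 0$ are such that every $d$-tuple of self-adjoint matrices $(X_1, \ldots, X_d)$ with all $\|X_j\| \leq 1$ admits a commuting self-adjoint dilation $(N_1, \ldots, N_d)$ with $\|N_j\| \leq a_j$. Then $\sum_{j=1}^d \frac{1}{a_j^2} \leq 1$. -/
/-- For every `d` there are `d` pairwise anti-commuting Hermitian unitary matrices. -/
theorem exists_anticommuting_hermitian_matrices (d : ℕ) :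
    ∃ (ι : Type) (_ : Fintype ι) (_ : DecidableEq ι) (_ : Nonempty ι)
      (F : Fin d → Matrix ι ι ℂ),
      (∀ j, (F j).IsHermitian) ∧ (∀ j, F j * F j = 1) ∧
        ∀ i j, i ≠ j → F i * F j = -(F j * F i) := by
  induction d with
  | zero =>
    exact ⟨Unit, inferInstance, inferInstance, inferInstance, fun j => j.elim0,
      fun j => j.elim0, fun j => j.elim0, fun j => j.elim0⟩
  | succ d ih =>
    obtain ⟨ι, _, _, _, F, hF, hsq, hanti⟩ := ih
    refine ⟨ι ⊕ ι, inferInstance, inferInstance, inferInstance,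
      Fin.cons (Matrix.fromBlocks 1 0 0 (-1)) fun j => Matrix.fromBlocks 0 (F j) (F j) 0,
      ?_, ?_, ?_⟩
    · intro j
      refine Fin.cases ?_ (fun j => ?_) j
      · simp [Matrix.IsHermitian, Matrix.fromBlocks_conjTranspose]
      · simp [Matrix.IsHermitian, Matrix.fromBlocks_conjTranspose, (hF j).eq]
    · intro j
      refine Fin.cases ?_ (fun j => ?_) j
      · simp [Matrix.fromBlocks_multiply]
      · simp [Matrix.fromBlocks_multiply, hsq j]
    · intro i j
      refine Fin.cases ?_ (fun i => ?_) i <;> refine Fin.cases ?_ (fun j => ?_) j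
      · simp
      · simp [Matrix.fromBlocks_multiply, Matrix.fromBlocks_neg]
      · simp [Matrix.fromBlocks_multiply, Matrix.fromBlocks_neg]
      · intro hij
        have h := hanti i j (fun h => hij (by rw [h]))
        simp [Matrix.fromBlocks_multiply, Matrix.fromBlocks_neg, h]

/-- For every `d` there are `d` pairwise anti-commuting self-adjoint unitaries on some
nonzero finite-dimensional Hilbert space. -/
theorem exists_anticommuting_selfAdjoint_unitaries (d : ℕ) :
    ∃ (n : ℕ) (_ : 0 < n)
      (F : Fin d → EuclideanSpace ℂ (Fin n) →L[ℂ] EuclideanSpace ℂ (Fin n)),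
      (∀ j, IsSelfAdjoint (F j)) ∧ (∀ j, F j * F j = 1) ∧
        ∀ i j, i ≠ j → F i * F j = -(F j * F i) := by
  obtain ⟨ι, _, _, _, F, hF, hsq, hanti⟩ := exists_anticommuting_hermitian_matrices d
  let e := Matrix.reindexAlgEquiv ℂ ℂ (Fintype.equivFin ι)
  refine ⟨Fintype.card ι, Fintype.card_pos,
    fun j => Matrix.toEuclideanCLM (𝕜 := ℂ) (e (F j)), fun j => ?_, fun j => ?_,
    fun i j hij => ?_⟩
  · refine IsSelfAdjoint.map (x := e (F j)) ?_ (Matrix.toEuclideanCLM (𝕜 := ℂ))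
    exact (hF j).submatrix _
  · rw [← map_mul, ← map_mul, hsq, map_one, map_one]
  · rw [← map_mul, ← map_mul, hanti i j hij, map_neg, map_neg, map_mul, map_mul]

/-- A double sum that is antisymmetric off the diagonal equals its diagonal part. -/
theorem sum_sum_eq_sum_diag_of_antisymm {ι : Type*} [Fintype ι] (f : ι → ι → ℝ)
    (hf : ∀ i j, i ≠ j → f i j = -f j i) : ∑ i, ∑ j, f i j = ∑ i, f i i := by
  classical
  have h1 : ∑ i, ∑ j, (f i j + f j i) = ∑ i, ∑ j, if i = j then 2 * f i i else 0 := by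
    refine Finset.sum_congr rfl fun i _ => Finset.sum_congr rfl fun j _ => ?_
    split_ifs with h
    · subst h; ring
    · rw [hf i j h]; ring
  simp only [Finset.sum_add_distrib, Finset.sum_ite_eq, Finset.mem_univ, if_true,
    ← Finset.mul_sum] at h1
  rw [Finset.sum_comm (f := fun i j => f j i)] at h1
  linarith

section HilbertSchmidt

variable {H K ι : Type*} [NormedAddCommGroup H] [InnerProductSpace ℂ H] [CompleteSpace H]
  [NormedAddCommGroup K] [InnerProductSpace ℂ K] [CompleteSpace K] [Fintype ι]

open ContinuousLinearMap (adjoint)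

theorem sum_inner_apply_eq_trace (b : OrthonormalBasis ι ℂ H) (A B : H →L[ℂ] K) :
    ∑ i, inner ℂ (A (b i)) (B (b i)) =
      LinearMap.trace ℂ H (adjoint A ∘L B : H →L[ℂ] H).toLinearMap := by
  rw [LinearMap.trace_eq_sum_inner _ b]
  simp [ContinuousLinearMap.adjoint_inner_right]

/-- Moving anti-commuting self-adjoint factors around the trace: the Hilbert-Schmidt inner
product of `M V F` and `N V G` is antisymmetric under exchanging the two pairs. -/
theorem sum_inner_eq_neg_of_anticommute (b : OrthonormalBasis ι ℂ H) (V : H →L[ℂ] K)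
    {M N : K →L[ℂ] K} (hM : IsSelfAdjoint M) (hN : IsSelfAdjoint N) (hMN : Commute M N)
    {F G : H →L[ℂ] H} (hF : IsSelfAdjoint F) (hG : IsSelfAdjoint G)
    (hFG : F * G = -(G * F)) :
    ∑ i, inner ℂ (M (V (F (b i)))) (N (V (G (b i)))) =
      -∑ i, inner ℂ (N (V (G (b i)))) (M (V (F (b i)))) := by
  have key : ∀ {M N : K →L[ℂ] K} {F G : H →L[ℂ] H}, IsSelfAdjoint M → IsSelfAdjoint F →
      ∑ i, inner ℂ (M (V (F (b i)))) (N (V (G (b i)))) =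
        LinearMap.trace ℂ H
          ((adjoint V ∘L (M * N) ∘L V).toLinearMap * (G * F : H →L[ℂ] H).toLinearMap) := by
    intro M N F G hM hF
    have h := sum_inner_apply_eq_trace b (M ∘L V ∘L F) (N ∘L V ∘L G)
    simp only [ContinuousLinearMap.comp_apply] at h
    rw [h]
    have h2 : adjoint (M ∘L V ∘L F) ∘L (N ∘L V ∘L G) =
        F * ((adjoint V ∘L (M * N) ∘L V) * G) := by
      rw [ContinuousLinearMap.adjoint_comp, ContinuousLinearMap.adjoint_comp,
        hM.adjoint_eq, hF.adjoint_eq]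
      rfl
    rw [h2]
    exact LinearMap.trace_mul_comm ℂ F.toLinearMap
      ((adjoint V ∘L (M * N) ∘L V) * G : H →L[ℂ] H).toLinearMap
  rw [key hM hF, key hN hG, hMN.eq, hFG, ← map_neg, ContinuousLinearMap.toLinearMap_neg,
    mul_neg, neg_neg]

/-- The Hilbert-Schmidt norm of `A F` equals that of `A` for a self-adjoint unitary `F`. -/
theorem sum_norm_sq_comp_unitary (b : OrthonormalBasis ι ℂ H) (A : H →L[ℂ] K)
    {F : H →L[ℂ] H} (hF : IsSelfAdjoint F) (hsq : F * F = 1) :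
    ∑ i, ‖A (F (b i))‖ ^ 2 = ∑ i, ‖A (b i)‖ ^ 2 := by
  have h1 := sum_inner_apply_eq_trace b (A ∘L F) (A ∘L F)
  have h2 := sum_inner_apply_eq_trace b A A
  have h3 : LinearMap.trace ℂ H (adjoint (A ∘L F) ∘L (A ∘L F)).toLinearMap =
      LinearMap.trace ℂ H (adjoint A ∘L A).toLinearMap := by
    have h4 : adjoint (A ∘L F) ∘L (A ∘L F) = F * ((adjoint A ∘L A) * F) := by
      rw [ContinuousLinearMap.adjoint_comp, hF.adjoint_eq]
      rfl
    have h5 : (adjoint A ∘L A) = ((adjoint A ∘L A) * F) * F := by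
      rw [mul_assoc, hsq, mul_one]
    rw [h4]
    conv_rhs => rw [h5]
    exact LinearMap.trace_mul_comm ℂ F.toLinearMap
      ((adjoint A ∘L A) * F : H →L[ℂ] H).toLinearMap
  rw [h3, ← h2] at h1
  simp only [ContinuousLinearMap.comp_apply, inner_self_eq_norm_sq_to_K] at h1
  exact_mod_cast h1

end HilbertSchmidt


/-- **Necessity of `∑ 1/a j² ≤ 1` for dilating the cube.**
Let `d ≥ 2` and `a 1, …, a d > 0` be such that every `d`-tuple of self-adjoint matrices
(operators on a finite-dimensional Hilbert space `ℂ^n`) of norm at most `1` admits a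
commuting self-adjoint dilation `N` with `‖N j‖ ≤ a j`.  Then `∑ 1/a j² ≤ 1`. -/
theorem cube_dilation_necessity (d : ℕ) (hd : 2 ≤ d)
    (a : Fin d → ℝ) (ha : ∀ j, 0 < a j)
    (hdil : ∀ (n : ℕ)
      (X : Fin d → EuclideanSpace ℂ (Fin n) →L[ℂ] EuclideanSpace ℂ (Fin n)),
      (∀ j, IsSelfAdjoint (X j)) → (∀ j, ‖X j‖ ≤ 1) →
      ∃ (K : Type) (_ : NormedAddCommGroup K) (_ : InnerProductSpace ℂ K)
        (_ : CompleteSpace K) (N : Fin d → K →L[ℂ] K)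
        (V : EuclideanSpace ℂ (Fin n) →L[ℂ] K),
        (∀ i j, Commute (N i) (N j)) ∧
        (∀ j, IsSelfAdjoint (N j)) ∧
        (∀ j, ‖N j‖ ≤ a j) ∧
        Isometry V ∧
        (∀ j, X j = ContinuousLinearMap.adjoint V ∘L N j ∘L V)) :
    ∑ j, 1 / (a j) ^ 2 ≤ 1 := by
  obtain ⟨n, hn, F, hF, hsq, hanti⟩ := exists_anticommuting_selfAdjoint_unitaries d
  have hF1 : ∀ j, ‖F j‖ ≤ 1 := by
    intro j
    have h : ‖F j‖ * ‖F j‖ ≤ 1 := by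
      rw [← CStarRing.norm_star_mul_self, (hF j).star_eq, hsq]
      exact ContinuousLinearMap.norm_id_le
    nlinarith [norm_nonneg (F j)]
  obtain ⟨K, _, _, _, N, V, hcomm, hN, hNa, hV, hdilN⟩ := hdil n F hF hF1
  let b := EuclideanSpace.basisFun (Fin n) ℂ
  have hVn : ∀ x, ‖V x‖ = ‖x‖ := hV.norm_map_of_map_zero (map_zero V)
  set t : Fin d → ℝ := fun j => 1 / (a j) ^ 2 with ht
  set s : ℝ := ∑ j, t j with hs
  let x : Fin n → Fin d → K := fun k j => N j (V (F j (b k)))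
  let S : Fin n → K := fun k => ∑ j, (t j : ℂ) • x k j
  have hin : ∀ k j, inner ℂ (V (b k)) (x k j) = 1 := by
    intro k j
    have h : ContinuousLinearMap.adjoint V (N j (V (F j (b k)))) = b k := by
      have h1 : F j (F j (b k)) = b k := DFunLike.congr_fun (hsq j) (b k)
      have h2 := DFunLike.congr_fun (hdilN j) (F j (b k))
      exact h2.symm.trans h1
    rw [← ContinuousLinearMap.adjoint_inner_right, h, inner_self_eq_norm_sq_to_K,
      b.norm_eq_one]
    simp
  have hlow : ∀ k, s ^ 2 ≤ ‖S k‖ ^ 2 := by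
    intro k
    have h1 : inner ℂ (V (b k)) (S k) = (s : ℂ) := by
      simp only [S, inner_sum, inner_smul_right, hin, mul_one, hs, Complex.ofReal_sum]
    have h2 := norm_inner_le_norm (𝕜 := ℂ) (V (b k)) (S k)
    rw [h1, hVn, b.norm_eq_one, one_mul, Complex.norm_real, Real.norm_eq_abs] at h2
    rw [← sq_abs s]
    gcongr
  have hexp : ∑ k, ‖S k‖ ^ 2 = ∑ i, ∑ j, t i * t j * (∑ k, inner ℂ (x k i) (x k j)).re := by
    have h : ∀ k, ‖S k‖ ^ 2 = ∑ i, ∑ j, t i * t j * (inner ℂ (x k i) (x k j)).re := by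
      intro k
      rw [← inner_self_eq_norm_sq (𝕜 := ℂ)]
      simp only [S, sum_inner, inner_sum, inner_smul_left, inner_smul_right,
        Complex.conj_ofReal, RCLike.re_to_complex, Complex.re_sum, Complex.re_ofReal_mul]
      simp only [← mul_assoc, Finset.mul_sum]
      rw [Finset.sum_comm]
      exact Finset.sum_congr rfl fun i _ => Finset.sum_congr rfl fun j _ => by
        rw [mul_comm (t i)]
    simp only [h, Complex.re_sum, Finset.mul_sum]
    rw [Finset.sum_comm]
    exact Finset.sum_congr rfl fun i _ => Finset.sum_comm
  have hdiag : ∀ j, (∑ k, inner ℂ (x k j) (x k j)).re ≤ (a j) ^ 2 * n := by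
    intro j
    have h1 : (∑ k, inner ℂ (x k j) (x k j)).re = ∑ k, ‖N j (V (b k))‖ ^ 2 := by
      rw [Complex.re_sum]
      refine Eq.trans ?_ (sum_norm_sq_comp_unitary b (N j ∘L V) (hF j) (hsq j))
      exact Finset.sum_congr rfl fun k _ => inner_self_eq_norm_sq (𝕜 := ℂ) (x k j)
    have h2 : ∀ k ∈ Finset.univ, ‖N j (V (b k))‖ ^ 2 ≤ (a j) ^ 2 := by
      intro k _
      have h3 := (N j).le_of_opNorm_le (hNa j) (V (b k))
      rw [hVn, b.norm_eq_one, mul_one] at h3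
      gcongr
    rw [h1]
    refine (Finset.sum_le_sum h2).trans_eq ?_
    simp [mul_comm]
  rw [sum_sum_eq_sum_diag_of_antisymm] at hexp
  · have hup : ∑ k, ‖S k‖ ^ 2 ≤ n * s := by
      rw [hexp, hs, Finset.mul_sum]
      refine Finset.sum_le_sum fun j _ => ?_
      refine (mul_le_mul_of_nonneg_left (hdiag j) (mul_self_nonneg (t j))).trans_eq ?_
      have := (ha j).ne'
      simp only [ht]
      field_simp
    have hsum : n * s ^ 2 ≤ ∑ k, ‖S k‖ ^ 2 := by
      have h := Finset.sum_le_sum fun k (_ : k ∈ Finset.univ) => hlow k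
      simpa using h
    have hn' : (0 : ℝ) < n := by exact_mod_cast hn
    have hs2 : s ^ 2 ≤ s := le_of_mul_le_mul_left (hsum.trans hup) hn'
    nlinarith
  · intro i j hij
    rw [sum_inner_eq_neg_of_anticommute b V (hN i) (hN j) (hcomm i j) (hF i) (hF j)
      (hanti i j hij), Complex.neg_re]
    ring
end

section
/- Let $X_1, \ldots, X_d$ be positive bounded operators on a Hilbert space $H$ such that for $i \neq j$, the only positive operator $T$ with $T \leq X_i$ and $T \leq X_j$ is $T = 0$. Suppose $(Y_1, \ldots, Y_d)$ is a tuple of commuting positive operators on a Hilbert space $K$ and $V: H \to K$ is an isometry with $X_i = V^* Y_i V$ for all $i$. Then there exist commuting positive operators $(Z_1, \ldots, Z_d)$ on $K$ with $Z_i Z_j = 0$ for $i \neq j$, $0 \leq Z_i \leq Y_i$, $X_i = V^* Z_i V$, and joint spectrum $\sigma(Z) \subseteq \sigma(Y) \cup \{0\}$. -/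
/-- `lam ∈ ℝ^d` lies in the joint spectrum of a commuting tuple `T` of self-adjoint
operators iff `∑ i (T i - lam i)²` is not bounded below by any `ε > 0`. -/
def MemJointSpectrum {K : Type*} [NormedAddCommGroup K] [InnerProductSpace ℂ K]
    [CompleteSpace K] {d : ℕ} (T : Fin d → K →L[ℂ] K)
    (lam : EuclideanSpace ℝ (Fin d)) : Prop :=
  ∀ ε : ℝ, 0 < ε → ¬ ((ε : ℂ) • (1 : K →L[ℂ] K) ≤ ∑ i, (T i - (lam i : ℂ) • 1) ^ 2)

open ContinuousLinearMap in
/-- A positive operator whose compression `S† T S` vanishes annihilates the range of `S`. -/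
lemma ContinuousLinearMap.comp_eq_zero_of_nonneg_of_adjoint_comp_comp_eq_zero
    {H K : Type*} [NormedAddCommGroup H] [InnerProductSpace ℂ H] [CompleteSpace H]
    [NormedAddCommGroup K] [InnerProductSpace ℂ K] [CompleteSpace K]
    {T : K →L[ℂ] K} (hT : 0 ≤ T) {S : H →L[ℂ] K} (h : adjoint S ∘L T ∘L S = 0) :
    T ∘L S = 0 := by
  have hR : CFC.sqrt T * CFC.sqrt T = T := CFC.sqrt_mul_sqrt_self T hT
  have hRpos : (CFC.sqrt T).IsPositive :=
    (nonneg_iff_isPositive _).1 (CFC.sqrt_nonneg T)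
  ext v
  have h0 : CFC.sqrt T (S v) = 0 := by
    rw [← inner_self_eq_zero (𝕜 := ℂ), hRpos.inner_left_eq_inner_right, ← mul_apply_eq_comp, hR,
      ← adjoint_inner_right]
    have := congr($h v)
    simp only [comp_apply, zero_apply] at this
    rw [this, inner_zero_right]
  rw [comp_apply, ← hR, mul_apply_eq_comp, h0, map_zero, zero_apply]

/-- A self-adjoint operator commutes with the projection onto an invariant subspace. -/
lemma IsSelfAdjoint.commute_starProjection_of_forall_mem
    {K : Type*} [NormedAddCommGroup K] [InnerProductSpace ℂ K] [CompleteSpace K]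
    {T : K →L[ℂ] K} (hT : IsSelfAdjoint T) {M : Submodule ℂ K} [M.HasOrthogonalProjection]
    (hM : ∀ x ∈ M, T x ∈ M) : Commute M.starProjection T := by
  have hP : IsSelfAdjoint M.starProjection := isSelfAdjoint_starProjection M
  have h : M.starProjection * T * M.starProjection = T * M.starProjection := by
    ext x
    simpa using Submodule.starProjection_eq_self_iff.2
      (hM _ (Submodule.starProjection_apply_mem M x))
  have h' := congr(star $h)
  simp only [star_mul, hP.star_eq, hT.star_eq, ← mul_assoc] at h'
  exact h'.symm.trans h

/-- In a C⋆-algebra, `a * b ≤ ‖b‖ • a` for commuting nonnegative elements `a`, `b`. -/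
lemma Commute.mul_le_norm_smul {A : Type*} [CStarAlgebra A] [PartialOrder A] [StarOrderedRing A]
    {a b : A} (hab : Commute a b) (ha : 0 ≤ a) (hb : 0 ≤ b) : a * b ≤ ‖b‖ • a := by
  have h : 0 ≤ algebraMap ℝ A ‖b‖ - b :=
    sub_nonneg.2 (IsSelfAdjoint.of_nonneg hb).le_algebraMap_norm_self
  have hc : Commute a (algebraMap ℝ A ‖b‖ - b) :=
    (Algebra.commute_algebraMap_right ‖b‖ a).sub_right hab
  have := hc.mul_nonneg ha h
  rwa [mul_sub, sub_nonneg, ← Algebra.commutes, ← Algebra.smul_def] at this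

/-- If the compressions of two commuting positive operators admit no nonzero common positive
lower bound, then the product of these operators annihilates the range of the compression. -/
lemma mul_comp_eq_zero_of_disjoint_compressions
    {H K : Type*} [NormedAddCommGroup H] [InnerProductSpace ℂ H] [CompleteSpace H]
    [NormedAddCommGroup K] [InnerProductSpace ℂ K] [CompleteSpace K]
    {A B : K →L[ℂ] K} (hA : 0 ≤ A) (hB : 0 ≤ B) (hAB : Commute A B) (V : H →L[ℂ] K)
    (h : ∀ T : H →L[ℂ] H, 0 ≤ T → T ≤ ContinuousLinearMap.adjoint V ∘L A ∘L V →
      T ≤ ContinuousLinearMap.adjoint V ∘L B ∘L V → T = 0) :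
    (A * B) ∘L V = 0 := by
  have compress : ∀ {S T : K →L[ℂ] K}, S ≤ T →
      ContinuousLinearMap.adjoint V ∘L S ∘L V ≤ ContinuousLinearMap.adjoint V ∘L T ∘L V := by
    intro S T hST
    rw [ContinuousLinearMap.le_def] at hST ⊢
    simpa [ContinuousLinearMap.sub_comp, ContinuousLinearMap.comp_sub] using hST.adjoint_conj V
  have scale : ∀ {r c : ℝ} {S T : K →L[ℂ] K}, 0 ≤ T → S ≤ r • T → 0 ≤ c → c * r ≤ 1 →
      c • S ≤ T := by
    intro r c S T hT hS hc hcr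
    calc c • S ≤ c • r • T := smul_le_smul_of_nonneg_left hS hc
      _ = (c * r) • T := smul_smul _ _ _
      _ ≤ (1 : ℝ) • T := smul_le_smul_of_nonneg_right hcr hT
      _ = T := one_smul _ _
  set c : ℝ := (1 + ‖A‖ + ‖B‖)⁻¹ with hc
  have hpos : 0 < 1 + ‖A‖ + ‖B‖ := by positivity
  have hc0 : 0 < c := inv_pos.2 hpos
  have hnn : 0 ≤ c • (A * B) := smul_nonneg hc0.le (hAB.mul_nonneg hA hB)
  have hleA : c • (A * B) ≤ A := by
    refine scale hA (hAB.mul_le_norm_smul hA hB) hc0.le ?_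
    rw [hc, inv_mul_le_one₀ hpos]
    linarith [norm_nonneg A]
  have hleB : c • (A * B) ≤ B := by
    rw [hAB.eq]
    refine scale hB (hAB.symm.mul_le_norm_smul hB hA) hc0.le ?_
    rw [hc, inv_mul_le_one₀ hpos]
    linarith [norm_nonneg B]
  have h0 := h _ (by simpa using compress hnn) (compress hleA) (compress hleB)
  have := ContinuousLinearMap.comp_eq_zero_of_nonneg_of_adjoint_comp_comp_eq_zero hnn h0
  rw [ContinuousLinearMap.smul_comp] at this
  exact (smul_eq_zero.1 this).resolve_left hc0.ne'

/-- Truncating a tuple of self-adjoint operators by a commuting projection only adds the origin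
to the joint spectrum. -/
lemma MemJointSpectrum.of_projection_mul
    {K : Type*} [NormedAddCommGroup K] [InnerProductSpace ℂ K] [CompleteSpace K]
    {d : ℕ} {T : Fin d → K →L[ℂ] K} {P : K →L[ℂ] K} (hP : IsStarProjection P)
    (hPT : ∀ i, Commute P (T i)) {lam : EuclideanSpace ℝ (Fin d)}
    (h : MemJointSpectrum (fun i ↦ P * T i) lam) : MemJointSpectrum T lam ∨ lam = 0 := by
  by_contra! hcon
  obtain ⟨hT, hlam⟩ := hcon
  unfold MemJointSpectrum at hT
  push Not at hT
  obtain ⟨ε, hε, hle⟩ := hT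
  set S := ∑ i, (T i - (lam i : ℂ) • 1) ^ 2 with hS
  set L : ℝ := ∑ i, lam i ^ 2 with hL
  have hL0 : 0 < L := by
    have : L = ‖lam‖ ^ 2 := (EuclideanSpace.real_norm_sq_eq lam).symm
    rw [this]
    positivity
  have hPP : P * P = P := hP.isIdempotentElem
  have hP0 : 0 ≤ P := hP.nonneg
  have hQ0 : 0 ≤ 1 - P := hP.one_sub.nonneg
  have hPS : Commute P S := Commute.sum_right _ _ _ fun i _ ↦
    ((hPT i).sub_right ((Commute.one_right P).smul_right _)).pow_right 2
  have hsum : ∑ i, (P * T i - (lam i : ℂ) • 1) ^ 2 = P * S + (L : ℂ) • (1 - P) := by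
    rw [hS, hL, Finset.mul_sum, Complex.ofReal_sum, Finset.sum_smul, ← Finset.sum_add_distrib]
    refine Finset.sum_congr rfl fun i _ ↦ ?_
    have h1 : P * T i * (P * T i) = P * (T i * T i) := by
      rw [mul_assoc, ← mul_assoc (T i), ← (hPT i).eq, mul_assoc, ← mul_assoc, hPP]
    simp only [sq, sub_mul, mul_sub, smul_mul_assoc, mul_smul_comm, one_mul, mul_one, h1,
      smul_sub, smul_smul, Complex.ofReal_mul]
    abel
  refine h (min ε L) (lt_min hε hL0) ?_
  rw [hsum, ← sub_nonneg]
  have hSε : 0 ≤ P * (S - (ε : ℂ) • 1) :=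
    (hPS.sub_right ((Commute.one_right P).smul_right _)).mul_nonneg hP0 (sub_nonneg.2 hle)
  have h2 : 0 ≤ ((ε - min ε L : ℝ) : ℂ) • P := by
    rw [Complex.coe_smul]
    exact smul_nonneg (sub_nonneg.2 (min_le_left _ _)) hP0
  have h3 : 0 ≤ ((L - min ε L : ℝ) : ℂ) • (1 - P) := by
    rw [Complex.coe_smul]
    exact smul_nonneg (sub_nonneg.2 (min_le_right _ _)) hQ0
  convert add_nonneg (add_nonneg hSε h2) h3 using 1
  simp only [mul_sub, mul_smul_comm, mul_one, Complex.ofReal_sub, sub_smul, smul_sub]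
  abel

/-- **From commuting positive dilations to annihilating dilations.**
Let `X 1, …, X d` be positive operators on `H` such that for `i ≠ j` the only positive
operator `T` with `T ≤ X i` and `T ≤ X j` is `T = 0`.  If `(Y 1, …, Y d)` is a tuple of
commuting positive operators on `K` and `V : H → K` is an isometry with
`X i = V* ∘ Y i ∘ V`, then there are commuting positive operators `(Z 1, …, Z d)` on
`K` with `Z i Z j = 0` for `i ≠ j`, `0 ≤ Z i ≤ Y i`, `X i = V* ∘ Z i ∘ V`, and joint
spectrum `σ(Z) ⊆ σ(Y) ∪ {0}`. -/
theorem annihilating_dilation_of_commuting_positive_dilation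
    {H K : Type*} [NormedAddCommGroup H] [InnerProductSpace ℂ H] [CompleteSpace H]
    [NormedAddCommGroup K] [InnerProductSpace ℂ K] [CompleteSpace K]
    {d : ℕ} (X : Fin d → H →L[ℂ] H)
    (hXpos : ∀ i, (0 : H →L[ℂ] H) ≤ X i)
    (hXdisj : ∀ i j, i ≠ j → ∀ T : H →L[ℂ] H, 0 ≤ T → T ≤ X i → T ≤ X j → T = 0)
    (Y : Fin d → K →L[ℂ] K)
    (hYpos : ∀ i, (0 : K →L[ℂ] K) ≤ Y i)
    (hYcomm : ∀ i j, Commute (Y i) (Y j))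
    (V : H →L[ℂ] K) (hV : Isometry V)
    (hXY : ∀ i, X i = ContinuousLinearMap.adjoint V ∘L Y i ∘L V) :
    ∃ Z : Fin d → K →L[ℂ] K,
      (∀ i j, Commute (Z i) (Z j)) ∧
      (∀ i j, i ≠ j → Z i * Z j = 0) ∧
      (∀ i, (0 : K →L[ℂ] K) ≤ Z i ∧ Z i ≤ Y i) ∧
      (∀ i, X i = ContinuousLinearMap.adjoint V ∘L Z i ∘L V) ∧
      (∀ lam : EuclideanSpace ℝ (Fin d),
        MemJointSpectrum Z lam → MemJointSpectrum Y lam ∨ lam = 0) := by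
  have hYsa : ∀ i, IsSelfAdjoint (Y i) := fun i ↦ IsSelfAdjoint.of_nonneg (hYpos i)
  have hYV : ∀ i j, i ≠ j → (Y i * Y j) ∘L V = 0 := fun i j hij ↦
    mul_comp_eq_zero_of_disjoint_compressions (hYpos i) (hYpos j) (hYcomm i j) V
      fun T h0 hi hj ↦ hXdisj i j hij T h0 (by rwa [hXY i]) (by rwa [hXY j])
  let M : Submodule ℂ K := ⨅ (i) (j) (_ : i ≠ j), (Y i * Y j).ker
  have hmem : ∀ x, x ∈ M ↔ ∀ i j, i ≠ j → (Y i * Y j) x = 0 := fun x ↦ by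
    simp only [M, Submodule.mem_iInf, LinearMap.mem_ker, ContinuousLinearMap.coe_coe]
  have hclosed : IsClosed (M : Set K) := by
    simp only [M, Submodule.coe_iInf]
    exact isClosed_iInter fun i ↦ isClosed_iInter fun j ↦ isClosed_iInter fun _ ↦
      (Y i * Y j).isClosed_ker
  have : CompleteSpace M := hclosed.completeSpace_coe
  set P : K →L[ℂ] K := M.starProjection
  have hP : IsStarProjection P := isStarProjection_starProjection
  have hPY : ∀ i, Commute P (Y i) := fun k ↦
    (hYsa k).commute_starProjection_of_forall_mem fun x hx ↦ (hmem _).2 fun i j hij ↦ by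
      have hc : Commute (Y i * Y j) (Y k) := (hYcomm i k).mul_left (hYcomm j k)
      rw [← mul_apply_eq_comp, hc.eq, mul_apply_eq_comp,
        (hmem x).1 hx i j hij, map_zero]
  have hPP : P * P = P := hP.isIdempotentElem
  have hmul : ∀ i j, P * Y i * (P * Y j) = Y i * Y j * P := fun i j ↦ by
    rw [(hPY i).eq, mul_assoc, ← mul_assoc P, hPP, (hPY j).eq, mul_assoc]
  have hPV : P ∘L V = V := by
    ext v
    exact Submodule.starProjection_eq_self_iff.2 ((hmem _).2 fun i j hij ↦ congr($(hYV i j hij) v))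
  refine ⟨fun i ↦ P * Y i, fun i j ↦ ?_, fun i j hij ↦ ?_, fun i ↦ ⟨?_, ?_⟩, fun i ↦ ?_,
    fun lam ↦ MemJointSpectrum.of_projection_mul hP hPY⟩
  · rw [commute_iff_eq, hmul, hmul, (hYcomm i j).eq]
  · rw [hmul]
    ext x
    exact (hmem _).1 (Submodule.starProjection_apply_mem M x) i j hij
  · exact (hPY i).mul_nonneg hP.nonneg (hYpos i)
  · have := ((Commute.one_left (Y i)).sub_left (hPY i)).mul_nonneg hP.one_sub.nonneg (hYpos i)
    rwa [sub_mul, one_mul, sub_nonneg] at this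
  · change X i = ContinuousLinearMap.adjoint V ∘L (P * Y i) ∘L V
    have h : (P * Y i) ∘L V = Y i ∘L V := by
      rw [(hPY i).eq]
      exact congr(Y i ∘L $hPV)
    rw [h, hXY i]
end
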